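/- Let H be a separable Hilbert space and T : H → H a compact self-adjoint operator. Suppose u ∈ H with ‖u‖ = 1, σ > 0, δ ≥ 0 satisfy ‖T u − σ u‖ ≤ δ. Then for every L > 0, the distance from u to the closed span of all eigenvectors of T with eigenvalue in the band [σ − L, σ + L] is at most 2δ/L. -/

import Mathlib

open scoped RealInnerProductSpace


theorem norm_le_of_components {H : Type*} [NormedAddCommGroup H] [InnerProductSpace ℝ H]
    [CompleteSpace H]
    (T : H →L[ℝ] H) (hTc : IsCompactOperator ⇑T) (hTs : (T : H →ₗ[ℝ] H).IsSymmetric)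
    (x y : H)
    (h : ∀ t : ℝ, ∃ c : ℝ, |c| ≤ 1 ∧ ∀ v : H, T v = t • v → ⟪v, x⟫ = c * ⟪v, y⟫) :
    ‖x‖ ≤ ‖y‖ := by
  classical
  have hbot := ContinuousLinearMap.orthogonalComplement_iSup_eigenspaces_eq_bot hTc hTs
  have hcomp : ∀ t : ℝ, CompleteSpace (Module.End.eigenspace (T : Module.End ℝ H) t) := by
    intro t
    have hc : IsClosed ((Module.End.eigenspace (T : Module.End ℝ H) t : Submodule ℝ H) : Set H) := by
      have : ((Module.End.eigenspace (T : Module.End ℝ H) t : Submodule ℝ H) : Set H)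
          = {v : H | T v = t • v} := by
        ext v
        simp [Module.End.mem_eigenspace_iff]
      rw [this]
      exact isClosed_eq T.continuous (continuous_const_smul t)
    exact hc.completeSpace_coe
  have hV := IsHilbertSum.mkInternal (𝕜 := ℝ)
    (F := fun t : ℝ => Module.End.eigenspace (T : Module.End ℝ H) t)
    hTs.orthogonalFamily_eigenspaces
    (by rw [Submodule.topologicalClosure_eq_top_iff.mpr hbot])
  have key : ∀ (z : H) (t : ℝ) (v : Module.End.eigenspace (T : Module.End ℝ H) t),
      ⟪v, hV.linearIsometryEquiv z t⟫ = ⟪(v : H), z⟫ := by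
    intro z t v
    have h1 := lp.inner_single_left (𝕜 := ℝ)
      (G := fun t : ℝ => Module.End.eigenspace (T : Module.End ℝ H) t) t v
      (hV.linearIsometryEquiv z)
    refine h1.symm.trans ?_
    have h2 := hV.linearIsometryEquiv.symm.inner_map_map (lp.single 2 t v)
      (hV.linearIsometryEquiv z)
    refine h2.symm.trans ?_
    rw [hV.linearIsometryEquiv_symm_apply_single, LinearIsometryEquiv.symm_apply_apply]
    rfl
  rw [← hV.linearIsometryEquiv.norm_map x, ← hV.linearIsometryEquiv.norm_map y]
  refine lp.norm_mono (by norm_num) fun t => ?_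
  obtain ⟨c, hc, hh⟩ := h t
  have : hV.linearIsometryEquiv x t = c • hV.linearIsometryEquiv y t := by
    refine ext_inner_left ℝ fun v => ?_
    rw [inner_smul_right, key, key]
    exact hh v (Module.End.mem_eigenspace_iff.mp v.2)
  rw [this, norm_smul, Real.norm_eq_abs]
  exact mul_le_of_le_one_left (norm_nonneg _) hc

/-- An approximate eigenvector of a compact self-adjoint operator is close to the
closed span of the eigenvectors whose eigenvalues lie in a band around the
approximate eigenvalue. -/
theorem stmt1 {H : Type*} [NormedAddCommGroup H] [InnerProductSpace ℝ H]
    [CompleteSpace H] [TopologicalSpace.SeparableSpace H]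
    (T : H →L[ℝ] H) (hTc : IsCompactOperator ⇑T) (hTsa : IsSelfAdjoint T)
    (u : H) (hu : ‖u‖ = 1) (σ δ : ℝ) (hσ : 0 < σ) (hδ : 0 ≤ δ)
    (happrox : ‖T u - σ • u‖ ≤ δ) (L : ℝ) (hL : 0 < L) :
    Metric.infDist u
      (((Submodule.span ℝ {v : H | ∃ t ∈ Set.Icc (σ - L) (σ + L),
        T v = t • v}).topologicalClosure : Submodule ℝ H) : Set H) ≤ 2 * δ / L := by
  have hTs : (T : H →ₗ[ℝ] H).IsSymmetric := hTsa.isSymmetric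
  set S := (Submodule.span ℝ {v : H | ∃ t ∈ Set.Icc (σ - L) (σ + L),
        T v = t • v}).topologicalClosure with hS
  have : CompleteSpace S := (Submodule.isClosed_topologicalClosure _).completeSpace_coe
  have hw : u - S.starProjection u ∈ Sᗮ := S.sub_starProjection_mem_orthogonal u
  have hp : S.starProjection u ∈ S := S.starProjection_apply_mem u
  have hmain : ‖L • (u - S.starProjection u)‖ ≤ ‖T u - σ • u‖ := by
    refine norm_le_of_components T hTc hTs _ _ fun t => ?_
    by_cases ht : t ∈ Set.Icc (σ - L) (σ + L)
    · refine ⟨0, by simp, fun v hv => ?_⟩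
      have hvS : v ∈ S :=
        Submodule.le_topologicalClosure _ (Submodule.subset_span ⟨t, ht, hv⟩)
      rw [inner_smul_right, hw v hvS]
      simp
    · have habs : L < |t - σ| := by
        by_contra! hcon
        rw [abs_le] at hcon
        exact ht ⟨by linarith [hcon.1], by linarith [hcon.2]⟩
      have hne : t - σ ≠ 0 := by
        intro h0
        rw [h0, abs_zero] at habs
        linarith
      refine ⟨L / (t - σ), ?_, fun v hv => ?_⟩
      · rw [abs_div, abs_of_pos hL]
        exact (div_le_one (hL.trans habs)).mpr habs.le
      · have hvS : S ≤ (ℝ ∙ v)ᗮ := by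
          refine Submodule.topologicalClosure_minimal _ ?_ (Submodule.isClosed_orthogonal _)
          rw [Submodule.span_le]
          rintro x ⟨s, hs, hx⟩
          rw [SetLike.mem_coe, Submodule.mem_orthogonal_singleton_iff_inner_right]
          have h1 : ⟪T v, x⟫ = ⟪v, T x⟫ := hTs v x
          rw [hv, hx, real_inner_smul_left, real_inner_smul_right] at h1
          have hts : t - s ≠ 0 := by
            intro h0
            exact ht (by rwa [sub_eq_zero.mp h0])
          have h2 : (t - s) * ⟪v, x⟫ = 0 := by linarith
          exact (mul_eq_zero.mp h2).resolve_left hts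
        have h0 : ⟪v, S.starProjection u⟫ = 0 :=
          Submodule.mem_orthogonal_singleton_iff_inner_right.mp (hvS hp)
        have h1 : ⟪T v, u⟫ = ⟪v, T u⟫ := hTs v u
        rw [hv, real_inner_smul_left] at h1
        rw [real_inner_smul_right, inner_sub_right, inner_sub_right, h0, ← h1,
          real_inner_smul_right]
        field_simp
        ring
  rw [norm_smul, Real.norm_eq_abs, abs_of_pos hL] at hmain
  have hd : Metric.infDist u (S : Set H) ≤ ‖u - S.starProjection u‖ := by
    rw [← dist_eq_norm]
    exact Metric.infDist_le_dist_of_mem hp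
  refine hd.trans ?_
  rw [le_div_iff₀ hL]
  linarith
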